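/- For every even integer t ≥ 4 there exists d₀ ∈ ℕ such that for all d ≥ d₀ and all m ≥ 1 the following holds. Let Z₁,…,Z_m ∈ ℝ^d, let v ∈ ℝ^d, and let q ∈ ℝ[u₁,…,u_d] be a homogeneous polynomial of degree t. Assume: (i) (1/m)·∑_{i=1}^m ‖Z_i‖^s ≤ s^{100s}·d^{s/2} for every integer 1 ≤ s ≤ t; (ii) ‖v‖ ≤ d^{−5t}; (iii) every coefficient of the polynomial (1/m)·∑_{i=1}^m ⟨Z_i,u⟩^t − q(u) in the monomial basis has absolute value at most d^{−10t}; (iv) t^{t/2}·‖u‖^t − q(u) is a sum of squares. Then 1.5·t^{t/2}·‖u‖^t − (1/m)·∑_{i=1}^m ⟨Z_i − v, u⟩^t is a sum of squares. -/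

import Mathlib

open MvPolynomial

lemma isSumSq_C {ι : Type*} {c : ℝ} (hc : 0 ≤ c) : IsSumSq (C c : MvPolynomial ι ℝ) := by
  rw [← Real.mul_self_sqrt hc, C_mul]
  exact IsSumSq.mul_self _

lemma isSumSq_pow {R : Type*} [CommSemiring R] {p : R} (hp : IsSumSq p) (n : ℕ) :
    IsSumSq (p ^ n) := by
  induction n with
  | zero => rw [pow_zero]; exact IsSumSq.one
  | succ n ih => rw [pow_succ]; exact ih.mul hp

lemma C_half_mul_two {ι : Type*} : (C (1 / 2) : MvPolynomial ι ℝ) * 2 = 1 := by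
  rw [show (2 : MvPolynomial ι ℝ) = C 2 from (map_ofNat C 2).symm, ← C_mul]
  norm_num

lemma isSumSq_sub_mul_of_sq {ι : Type*} {M P Q : MvPolynomial ι ℝ} (hP : IsSumSq (M - P ^ 2))
    (hQ : IsSumSq (M - Q ^ 2)) : IsSumSq (M - P * Q) := by
  have key : M - P * Q = C (1 / 2) * ((M - P ^ 2) + (M - Q ^ 2) + (P - Q) ^ 2) := by
    linear_combination (-(M - P * Q)) * C_half_mul_two
  rw [key]
  exact (isSumSq_C (by norm_num)).mul ((hP.add hQ).add (IsSquare.sq _).isSumSq)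

lemma Finsupp.exists_list_sum_single {ι : Type*} (α : ι →₀ ℕ) :
    ∃ l : List ι, l.length = α.degree ∧ (l.map fun j => Finsupp.single j 1).sum = α := by
  induction α using Finsupp.induction_linear with
  | zero => exact ⟨[], by simp, by simp⟩
  | add α β hα hβ =>
    obtain ⟨l, hl, rfl⟩ := hα
    obtain ⟨l', hl', rfl⟩ := hβ
    exact ⟨l ++ l', by rw [List.length_append, hl, hl', map_add], by simp⟩
  | single j n => exact ⟨List.replicate n j, by simp, by simp⟩

lemma degree_eq_of_isHomogeneous {ι : Type*} {n : ℕ} {p : MvPolynomial ι ℝ}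
    (hp : p.IsHomogeneous n) {α : ι →₀ ℕ} (hα : α ∈ p.support) : α.degree = n :=
  (DFunLike.congr_fun Finsupp.degree_eq_weight_one α).trans (hp (mem_support_iff.1 hα))

section LinearForms

variable {ι : Type*} [Fintype ι]

/-- The linear form `u ↦ ⟨a, u⟩` as a polynomial. -/
noncomputable def linearForm (a : EuclideanSpace ℝ ι) : MvPolynomial ι ℝ := ∑ j, C (a j) * X j

/-- The polynomial `u ↦ ‖u‖ ^ 2`. -/
noncomputable def normSqPoly (ι : Type*) [Fintype ι] : MvPolynomial ι ℝ := ∑ j, X j ^ 2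

lemma linearForm_smul (c : ℝ) (a : EuclideanSpace ℝ ι) :
    linearForm (c • a) = C c * linearForm a := by
  simp [linearForm, Finset.mul_sum, mul_assoc]

lemma linearForm_add (a b : EuclideanSpace ℝ ι) :
    linearForm (a + b) = linearForm a + linearForm b := by
  simp [linearForm, add_mul, Finset.sum_add_distrib]

lemma linearForm_single [DecidableEq ι] (j : ι) :
    linearForm (EuclideanSpace.single j (1 : ℝ)) = X j := by
  simp [linearForm]

lemma linearForm_isHomogeneous (a : EuclideanSpace ℝ ι) : (linearForm a).IsHomogeneous 1 :=
  IsHomogeneous.sum _ _ _ fun j _ => isHomogeneous_C_mul_X _ j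

lemma isSumSq_normSqPoly : IsSumSq (normSqPoly ι) :=
  IsSumSq.sum fun j _ => (IsSquare.sq (X j)).isSumSq

lemma isSumSq_sub_mono {k : ℕ} {b c : ℝ} (hbc : b ≤ c) {p : MvPolynomial ι ℝ}
    (h : IsSumSq (C b * normSqPoly ι ^ k - p)) : IsSumSq (C c * normSqPoly ι ^ k - p) := by
  have key : C c * normSqPoly ι ^ k - p
      = (C b * normSqPoly ι ^ k - p) + C (c - b) * normSqPoly ι ^ k := by
    rw [C_sub]
    ring
  rw [key]
  exact h.add ((isSumSq_C (sub_nonneg.2 hbc)).mul (isSumSq_pow isSumSq_normSqPoly k))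

/-- Lagrange's identity turns the Cauchy–Schwarz inequality into a sum of squares. -/
lemma isSumSq_normSqPoly_sub_linearForm_sq {a : EuclideanSpace ℝ ι} (ha : ‖a‖ ≤ 1) :
    IsSumSq (normSqPoly ι - linearForm a ^ 2) := by
  have hC : (C (‖a‖ ^ 2) : MvPolynomial ι ℝ) = ∑ j, C (a j) ^ 2 := by
    simp [EuclideanSpace.norm_sq_eq]
  have lagrange : ∑ i, ∑ j, (C (a i) * X j - C (a j) * X i) ^ 2
      = 2 * (C (‖a‖ ^ 2) * normSqPoly ι - linearForm a ^ 2) := by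
    have h (i j : ι) : (C (a i) * X j - C (a j) * X i : MvPolynomial ι ℝ) ^ 2
        = C (a i) ^ 2 * X j ^ 2 + X i ^ 2 * C (a j) ^ 2
          - 2 * ((C (a i) * X i) * (C (a j) * X j)) := by ring
    simp only [h, Finset.sum_sub_distrib, Finset.sum_add_distrib, ← Finset.mul_sum,
      ← Finset.sum_mul]
    rw [hC, normSqPoly, linearForm]
    ring
  have key : normSqPoly ι - linearForm a ^ 2 = C (1 - ‖a‖ ^ 2) * normSqPoly ι
      + C (1 / 2) * ∑ i, ∑ j, (C (a i) * X j - C (a j) * X i) ^ 2 := by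
    rw [lagrange, C_sub, C_1]
    linear_combination (-(C (‖a‖ ^ 2) * normSqPoly ι - linearForm a ^ 2)) * C_half_mul_two
  rw [key]
  refine ((isSumSq_C ?_).mul isSumSq_normSqPoly).add ((isSumSq_C (by norm_num)).mul ?_)
  · nlinarith [norm_nonneg a]
  · exact IsSumSq.sum fun i _ => IsSumSq.sum fun j _ => (IsSquare.sq _).isSumSq

lemma isSumSq_normSqPoly_pow_sub_prod_sq (l : List (EuclideanSpace ℝ ι))
    (hl : ∀ a ∈ l, ‖a‖ ≤ 1) :
    IsSumSq (normSqPoly ι ^ l.length - (l.map linearForm).prod ^ 2) := by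
  induction l with
  | nil => simp
  | cons a l ih =>
    have key : normSqPoly ι ^ (a :: l).length - ((a :: l).map linearForm).prod ^ 2
        = (normSqPoly ι - linearForm a ^ 2) * normSqPoly ι ^ l.length
          + linearForm a ^ 2 * (normSqPoly ι ^ l.length - (l.map linearForm).prod ^ 2) := by
      simp only [List.length_cons, List.map_cons, List.prod_cons]
      ring
    rw [key]
    refine ((isSumSq_normSqPoly_sub_linearForm_sq (hl a (by simp))).mul
      (isSumSq_pow isSumSq_normSqPoly _)).add ((IsSquare.sq _).isSumSq.mul (ih fun b hb => ?_))
    exact hl b (by simp [hb])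

lemma isSumSq_sub_prod_linearForm_of_norm_le_one {k : ℕ} (l : List (EuclideanSpace ℝ ι))
    (hlen : l.length = k + k) (hl : ∀ a ∈ l, ‖a‖ ≤ 1) :
    IsSumSq (normSqPoly ι ^ k - (l.map linearForm).prod) ∧
      IsSumSq (normSqPoly ι ^ k + (l.map linearForm).prod) := by
  have hP := isSumSq_normSqPoly_pow_sub_prod_sq (l.take k) fun a ha =>
    hl a (List.mem_of_mem_take ha)
  have hQ := isSumSq_normSqPoly_pow_sub_prod_sq (l.drop k) fun a ha =>
    hl a (List.mem_of_mem_drop ha)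
  rw [show (l.take k).length = k by simp [hlen]] at hP
  rw [show (l.drop k).length = k by simp [hlen]] at hQ
  have hsplit : (l.map linearForm).prod
      = ((l.take k).map linearForm).prod * ((l.drop k).map linearForm).prod := by
    rw [← List.prod_append, ← List.map_append, List.take_append_drop]
  rw [hsplit]
  refine ⟨isSumSq_sub_mul_of_sq hP hQ, ?_⟩
  have h := isSumSq_sub_mul_of_sq (P := -((l.take k).map linearForm).prod)
    (by rwa [neg_sq]) hQ
  rwa [neg_mul, sub_neg_eq_add] at h

lemma isSumSq_sub_C_mul_prod_linearForm_of_norm_le_one {k : ℕ} (c : ℝ)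
    (l : List (EuclideanSpace ℝ ι)) (hlen : l.length = k + k) (hl : ∀ a ∈ l, ‖a‖ ≤ 1) :
    IsSumSq (C |c| * normSqPoly ι ^ k - C c * (l.map linearForm).prod) := by
  obtain ⟨hsub, hadd⟩ := isSumSq_sub_prod_linearForm_of_norm_le_one l hlen hl
  rcases le_total 0 c with hc | hc
  · rw [abs_of_nonneg hc, ← mul_sub]
    exact (isSumSq_C hc).mul hsub
  · rw [abs_of_nonpos hc, show C (-c) * normSqPoly ι ^ k - C c * (l.map linearForm).prod
      = C (-c) * (normSqPoly ι ^ k + (l.map linearForm).prod) by rw [C_neg]; ring]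
    exact (isSumSq_C (by linarith)).mul hadd

lemma isSumSq_sub_prod_linearForm {k : ℕ} (l : List (EuclideanSpace ℝ ι))
    (hlen : l.length = k + k) :
    IsSumSq (C (l.map norm).prod * normSqPoly ι ^ k - (l.map linearForm).prod) := by
  have hprod : (l.map linearForm).prod = C (l.map norm).prod *
      ((l.map fun a => ‖a‖⁻¹ • a).map linearForm).prod := by
    clear hlen
    induction l with
    | nil => simp
    | cons a l ih =>
      have ha : linearForm a = C ‖a‖ * linearForm (‖a‖⁻¹ • a) := by
        rw [← linearForm_smul, smul_smul]
        rcases eq_or_ne a 0 with rfl | h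
        · simp
        · rw [mul_inv_cancel₀ (norm_ne_zero_iff.2 h), one_smul]
      simp only [List.map_cons, List.prod_cons, C_mul]
      rw [ih, ha]
      ring
  have hnonneg : 0 ≤ (l.map norm).prod := List.prod_nonneg (by simp)
  have h := isSumSq_sub_C_mul_prod_linearForm_of_norm_le_one (k := k) (l.map norm).prod
    (l.map fun a => ‖a‖⁻¹ • a) (by simpa using hlen) (by
      simp only [List.mem_map, forall_exists_index, and_imp, forall_apply_eq_imp_iff₂]
      intro a _
      rw [norm_smul, norm_inv, norm_norm]
      exact inv_mul_le_one)
  rwa [abs_of_nonneg hnonneg, ← hprod] at h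

/-- The binomial expansion of `⟨a + b, u⟩ ^ (2 * k)` around `⟨a, u⟩ ^ (2 * k)`. -/
lemma isSumSq_sub_linearForm_add_pow_sub (k : ℕ) (a b : EuclideanSpace ℝ ι) :
    IsSumSq (C (∑ s ∈ Finset.range (k + k), ‖a‖ ^ s * ‖b‖ ^ (k + k - s) * (k + k).choose s)
        * normSqPoly ι ^ k - (linearForm (a + b) ^ (k + k) - linearForm a ^ (k + k))) := by
  have expand : linearForm (a + b) ^ (k + k) - linearForm a ^ (k + k)
      = ∑ s ∈ Finset.range (k + k),
        linearForm a ^ s * linearForm b ^ (k + k - s) * (k + k).choose s := by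
    rw [linearForm_add, add_pow, Finset.sum_range_succ]
    simp
  rw [expand, map_sum, Finset.sum_mul, ← Finset.sum_sub_distrib]
  refine IsSumSq.sum fun s hs => ?_
  have hlen : (List.replicate s a ++ List.replicate (k + k - s) b).length = k + k := by
    have := Finset.mem_range.1 hs
    simp; omega
  have h := (isSumSq_C (ι := ι) (Nat.cast_nonneg ((k + k).choose s))).mul
    (isSumSq_sub_prod_linearForm _ hlen)
  refine (congrArg IsSumSq ?_).mp h
  simp only [List.map_append, List.map_replicate, List.prod_append, List.prod_replicate, C_mul,
    map_natCast]
  ring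

lemma isSumSq_sub_monomial {k : ℕ} {α : ι →₀ ℕ} (hα : α.degree = k + k) (c : ℝ) :
    IsSumSq (C |c| * normSqPoly ι ^ k - monomial α c) := by
  classical
  obtain ⟨l, hlen, rfl⟩ := Finsupp.exists_list_sum_single α
  have h := isSumSq_sub_C_mul_prod_linearForm_of_norm_le_one (k := k) c
    (l.map fun j => EuclideanSpace.single j (1 : ℝ)) (by simpa using hlen.trans hα) (by simp)
  have hprod : ((l.map fun j => EuclideanSpace.single j (1 : ℝ)).map linearForm).prod
      = monomial (l.map fun j => Finsupp.single j 1).sum (1 : ℝ) := by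
    clear h hlen hα
    induction l with
    | nil => simp
    | cons j l ih =>
      simp only [List.map_cons, List.prod_cons, List.sum_cons]
      rw [ih, linearForm_single, X, monomial_mul, one_mul]
  rwa [hprod, C_mul_monomial, mul_one] at h

lemma card_support_le_of_isHomogeneous {n : ℕ} {p : MvPolynomial ι ℝ} (hp : p.IsHomogeneous n) :
    p.support.card ≤ Fintype.card ι ^ n := by
  classical
  have hsub : p.support ⊆ Finset.univ.image
      fun f : Fin n → ι => (List.ofFn fun i => Finsupp.single (f i) 1).sum := by
    intro α hα
    obtain ⟨l, hlen, hl⟩ := Finsupp.exists_list_sum_single α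
    obtain rfl := hlen.trans (degree_eq_of_isHomogeneous hp hα)
    refine Finset.mem_image.2 ⟨l.get, Finset.mem_univ _, ?_⟩
    have h := List.map_ofFn (f := l.get) (g := fun j => Finsupp.single j 1)
    rw [List.ofFn_get] at h
    exact (congrArg List.sum h).symm.trans hl
  calc p.support.card ≤ _ := Finset.card_le_card hsub
    _ ≤ _ := Finset.card_image_le
    _ = Fintype.card ι ^ n := by simp

/-- A form of degree `2 * k` with coefficients at most `ε` is dominated by `‖u‖ ^ (2 * k)`. -/
lemma isSumSq_sub_of_abs_coeff_le {k : ℕ} {p : MvPolynomial ι ℝ} (hp : p.IsHomogeneous (k + k))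
    {ε : ℝ} (hε : 0 ≤ ε) (hcoeff : ∀ α, |p.coeff α| ≤ ε) :
    IsSumSq (C ((Fintype.card ι : ℝ) ^ (k + k) * ε) * normSqPoly ι ^ k - p) := by
  have hle : ∑ α ∈ p.support, |p.coeff α| ≤ (Fintype.card ι : ℝ) ^ (k + k) * ε := by
    calc ∑ α ∈ p.support, |p.coeff α| ≤ p.support.card • ε :=
          Finset.sum_le_card_nsmul _ _ _ fun α _ => hcoeff α
      _ ≤ (Fintype.card ι : ℝ) ^ (k + k) * ε := by
          rw [nsmul_eq_mul]
          gcongr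
          exact_mod_cast card_support_le_of_isHomogeneous hp
  have hsum : IsSumSq (C (∑ α ∈ p.support, |p.coeff α|) * normSqPoly ι ^ k - p) := by
    nth_rewrite 3 [p.as_sum]
    rw [map_sum, Finset.sum_mul, ← Finset.sum_sub_distrib]
    exact IsSumSq.sum fun α hα => isSumSq_sub_monomial (degree_eq_of_isHomogeneous hp hα) _
  exact isSumSq_sub_mono hle hsum

end LinearForms

/-- The total error caused by moving the samples by `v`, bounded through their moments. -/
lemma empirical_shift_error_le {t d m : ℕ} (hd : 1 ≤ d) (hm : 1 ≤ m)
    {E : Type*} [SeminormedAddCommGroup E] (Z : Fin m → E) {v : E}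
    (hZ : ∀ s : ℕ, 1 ≤ s → s ≤ t →
      (m : ℝ)⁻¹ * ∑ i : Fin m, ‖Z i‖ ^ s ≤ (s : ℝ) ^ (100 * s) * (d : ℝ) ^ ((s : ℝ) / 2))
    (hv : ‖v‖ ≤ (d : ℝ) ^ (-(5 * (t : ℝ)))) :
    (m : ℝ)⁻¹ * ∑ i : Fin m, ∑ s ∈ Finset.range t, ‖Z i‖ ^ s * ‖v‖ ^ (t - s) * t.choose s
      ≤ 2 ^ t * (t : ℝ) ^ (100 * t) * (d : ℝ)⁻¹ := by
  have hd1 : (1 : ℝ) ≤ d := by exact_mod_cast hd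
  have hd0 : (0 : ℝ) < d := by linarith
  have hmoment (s : ℕ) (hs : s < t) :
      (m : ℝ)⁻¹ * ∑ i : Fin m, ‖Z i‖ ^ s ≤ (t : ℝ) ^ (100 * t) * (d : ℝ) ^ (t : ℝ) := by
    have ht1 : (1 : ℝ) ≤ t := by exact_mod_cast (by omega : 1 ≤ t)
    have hst : (s : ℝ) ≤ t := by exact_mod_cast hs.le
    rcases Nat.eq_zero_or_pos s with rfl | hpos
    · have hmne : (m : ℝ) ≠ 0 := by positivity
      have hone : (m : ℝ)⁻¹ * ∑ i : Fin m, ‖Z i‖ ^ 0 = 1 := by simp [hmne]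
      rw [hone]
      exact one_le_mul_of_one_le_of_one_le (one_le_pow₀ ht1)
        (Real.one_le_rpow hd1 (by positivity))
    · refine (hZ s hpos hs.le).trans ?_
      have hexp : (s : ℝ) / 2 ≤ t := by linarith [Nat.cast_nonneg (α := ℝ) s]
      have hpow : (s : ℝ) ^ (100 * s) ≤ (t : ℝ) ^ (100 * t) :=
        (pow_le_pow_left₀ (by positivity) hst _).trans (pow_le_pow_right₀ ht1 (by omega))
      gcongr
  have hshift (s : ℕ) (hs : s < t) : ‖v‖ ^ (t - s) ≤ (d : ℝ) ^ (-(5 * (t : ℝ))) := by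
    have hle : ‖v‖ ≤ 1 :=
      hv.trans (Real.rpow_le_one_of_one_le_of_nonpos hd1 (by simp))
    exact (pow_le_of_le_one (norm_nonneg v) hle (by omega)).trans hv
  have hdecay (s : ℕ) (hs : s < t) :
      (d : ℝ) ^ (t : ℝ) * (d : ℝ) ^ (-(5 * (t : ℝ))) ≤ (d : ℝ)⁻¹ := by
    have ht1 : (1 : ℝ) ≤ t := by exact_mod_cast (by omega : 1 ≤ t)
    rw [← Real.rpow_add hd0, ← Real.rpow_neg_one]
    exact Real.rpow_le_rpow_of_exponent_le hd1 (by linarith)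
  have hchoose : ∑ s ∈ Finset.range t, (t.choose s : ℝ) ≤ 2 ^ t := by
    rw [← Nat.cast_sum]
    exact_mod_cast (Finset.sum_le_sum_of_subset (Finset.range_subset_range.2 t.le_succ)).trans
      (Nat.sum_range_choose t).le
  rw [Finset.sum_comm, Finset.mul_sum]
  calc ∑ s ∈ Finset.range t, (m : ℝ)⁻¹ * ∑ i : Fin m, ‖Z i‖ ^ s * ‖v‖ ^ (t - s) * t.choose s
      = ∑ s ∈ Finset.range t,
          ((m : ℝ)⁻¹ * ∑ i : Fin m, ‖Z i‖ ^ s) * ‖v‖ ^ (t - s) * t.choose s := by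
        simp only [← Finset.sum_mul, mul_assoc]
    _ ≤ ∑ s ∈ Finset.range t, ((t : ℝ) ^ (100 * t) * (d : ℝ)⁻¹) * t.choose s := by
        refine Finset.sum_le_sum fun s hs => ?_
        have hs := Finset.mem_range.1 hs
        refine mul_le_mul_of_nonneg_right ?_ (by positivity)
        calc _ ≤ ((t : ℝ) ^ (100 * t) * (d : ℝ) ^ (t : ℝ)) * (d : ℝ) ^ (-(5 * (t : ℝ))) :=
              mul_le_mul (hmoment s hs) (hshift s hs) (by positivity) (by positivity)
          _ ≤ _ := by
              rw [mul_assoc]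
              exact mul_le_mul_of_nonneg_left (hdecay s hs) (by positivity)
    _ ≤ 2 ^ t * (t : ℝ) ^ (100 * t) * (d : ℝ)⁻¹ := by
        rw [← Finset.mul_sum, mul_comm, mul_assoc (2 ^ t : ℝ)]
        gcongr

/-- **Recentering preserves SoS-certified moment bounds.** For every even `t ≥ 4` there is
`d₀` such that for `d ≥ d₀`, `m ≥ 1`: if samples `Zᵢ` have bounded empirical norms (i), the
shift `v` is tiny (ii), the empirical `t`-th moment polynomial has coefficients `d^{-10t}`-
close to a homogeneous degree-`t` polynomial `q` (iii) with `t^{t/2}‖u‖^t - q` a sum of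
squares (iv), then `1.5·t^{t/2}‖u‖^t - (1/m)∑⟨Zᵢ - v, u⟩^t` is a sum of squares. -/
theorem stmt_19 (t : ℕ) (hte : Even t) (ht4 : 4 ≤ t) :
    ∃ d₀ : ℕ, ∀ d : ℕ, d₀ ≤ d → ∀ m : ℕ, 1 ≤ m →
    ∀ (Z : Fin m → EuclideanSpace ℝ (Fin d)) (v : EuclideanSpace ℝ (Fin d))
      (q : MvPolynomial (Fin d) ℝ), q.IsHomogeneous t →
    (∀ s : ℕ, 1 ≤ s → s ≤ t →
      (m : ℝ)⁻¹ * ∑ i : Fin m, ‖Z i‖ ^ s ≤ (s : ℝ) ^ (100 * s) * (d : ℝ) ^ ((s : ℝ) / 2)) →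
    ‖v‖ ≤ (d : ℝ) ^ (-(5 * (t : ℝ))) →
    (∀ α : Fin d →₀ ℕ,
      |(C ((m : ℝ)⁻¹) * ∑ i : Fin m, (∑ j : Fin d, C (Z i j) * X j) ^ t - q).coeff α|
        ≤ (d : ℝ) ^ (-(10 * (t : ℝ)))) →
    IsSumSq (C ((t : ℝ) ^ (t / 2)) * (∑ j : Fin d, X j ^ 2) ^ (t / 2) - q) →
    IsSumSq (C (1.5 * (t : ℝ) ^ (t / 2)) * (∑ j : Fin d, X j ^ 2) ^ (t / 2)
      - C ((m : ℝ)⁻¹) * ∑ i : Fin m, (∑ j : Fin d, C (Z i j - v j) * X j) ^ t) := by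
  obtain ⟨k, rfl⟩ := hte
  set t := k + k with ht
  have htk : t / 2 = k := by omega
  rw [htk]
  refine ⟨2 * (1 + 2 ^ t * t ^ (100 * t)), fun d hd m hm Z v q hq hZ hv hcoeff hsos => ?_⟩
  have hd1 : (1 : ℝ) ≤ d := by
    have : 1 ≤ d := by omega
    exact_mod_cast this
  have hm0 : (0 : ℝ) ≤ (m : ℝ)⁻¹ := by positivity
  have hempirical : (C ((m : ℝ)⁻¹) * ∑ i : Fin m, linearForm (Z i) ^ t
      - q).IsHomogeneous (k + k) := by
    refine IsHomogeneous.sub (IsHomogeneous.C_mul (IsHomogeneous.sum _ _ _ fun i _ => ?_) _) hq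
    simpa using (linearForm_isHomogeneous (Z i)).pow t
  have hclose := isSumSq_sub_of_abs_coeff_le hempirical (by positivity) hcoeff
  have hshift : IsSumSq (C ((m : ℝ)⁻¹ * ∑ i : Fin m, ∑ s ∈ Finset.range t,
      ‖Z i‖ ^ s * ‖v‖ ^ (t - s) * t.choose s) * normSqPoly (Fin d) ^ k
      - C ((m : ℝ)⁻¹) * ∑ i : Fin m, (linearForm (Z i - v) ^ t - linearForm (Z i) ^ t)) := by
    rw [C_mul, mul_assoc, ← mul_sub, map_sum, Finset.sum_mul, ← Finset.sum_sub_distrib]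
    refine (isSumSq_C hm0).mul (IsSumSq.sum fun i _ => ?_)
    have h := isSumSq_sub_linearForm_add_pow_sub k (Z i) (-v)
    rwa [norm_neg, ← sub_eq_add_neg] at h
  have herror := hclose.add hshift
  rw [Fintype.card_fin, sub_add_sub_comm, ← add_mul, ← C_add, Finset.sum_sub_distrib, mul_sub,
    sub_add_sub_comm, add_comm q, add_sub_add_left_eq_sub] at herror
  have hconst : (d : ℝ) ^ t * (d : ℝ) ^ (-(10 * (t : ℝ))) + (m : ℝ)⁻¹ * ∑ i : Fin m,
      ∑ s ∈ Finset.range t, ‖Z i‖ ^ s * ‖v‖ ^ (t - s) * t.choose s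
      ≤ 1 / 2 * (t : ℝ) ^ k := by
    have hd0 : (0 : ℝ) < d := by linarith
    have ht4' : (4 : ℝ) ≤ t := by exact_mod_cast ht4
    have hcoeffs : (d : ℝ) ^ t * (d : ℝ) ^ (-(10 * (t : ℝ))) ≤ (d : ℝ)⁻¹ := by
      rw [← Real.rpow_natCast, ← Real.rpow_add hd0, ← Real.rpow_neg_one]
      exact Real.rpow_le_rpow_of_exponent_le hd1 (by linarith)
    have hsmall : (1 + (2 : ℝ) ^ t * (t : ℝ) ^ (100 * t)) * (d : ℝ)⁻¹ ≤ 1 / 2 := by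
      rw [← div_eq_mul_inv, div_le_iff₀ hd0]
      have : (2 : ℝ) * (1 + 2 ^ t * (t : ℝ) ^ (100 * t)) ≤ d := by exact_mod_cast hd
      linarith
    have hpow : (1 : ℝ) ≤ (t : ℝ) ^ k := one_le_pow₀ (by linarith)
    linarith [empirical_shift_error_le (by exact_mod_cast hd1) hm Z hZ hv]
  have hsum := hsos.add (isSumSq_sub_mono hconst herror)
  rw [show (1.5 * (t : ℝ) ^ k) = (t : ℝ) ^ k + 1 / 2 * (t : ℝ) ^ k by ring,
    C_add, add_mul]
  have hlin (i : Fin m) : ∑ j, C (Z i j - v j) * X j = linearForm (Z i - v) := rfl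
  simp only [hlin]
  rwa [normSqPoly, sub_add_sub_comm, add_sub_cancel] at hsum
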